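/- arXiv:2008.09065 — 2 statements merged into one kernel-verified Lean document; each statement's English description precedes it below -/
import Mathlib

section
/- The work benefit of a measurement is determined by the target system alone: let ρ_s be a density matrix on ℂ^{d_a} ⊗ ℂ^{d_t} with target marginal ρ_t = Tr_a[ρ_s], and let C_1, …, C_n be completely positive linear maps on d_t×d_t matrices whose sum is trace preserving. Set p_i = Tr[(id ⊗ C_i)(ρ_s)] (which equals Tr[C_i(ρ_t)]), σ_{s,i} = (id ⊗ C_i)(ρ_s)/p_i and σ_{t,i} = C_i(ρ_t)/p_i for those i with p_i > 0. Then S(ρ_s) − ∑_{i : p_i>0} p_i S(σ_{s,i}) ≤ S(ρ_t) − ∑_{i : p_i>0} p_i S(σ_{t,i}). -/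
open scoped ComplexOrder
open Matrix

/-- A density matrix: positive semidefinite with trace one. -/
def IsDensityMatrix {ι : Type*} [Fintype ι] (ρ : Matrix ι ι ℂ) : Prop :=
  ρ.PosSemidef ∧ ρ.trace = 1

/-- The von Neumann entropy `S(ρ) = -∑ₖ λₖ log λₖ` of a (Hermitian) matrix,
with the convention `0 log 0 = 0`. -/
noncomputable def vN {ι : Type*} [Fintype ι] [DecidableEq ι] (ρ : Matrix ι ι ℂ) : ℝ :=
  if h : ρ.IsHermitian then ∑ k, Real.negMulLog (h.eigenvalues k) else 0

/-- Complete positivity: every amplification `id_n ⊗ Φ` (acting blockwise on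
block matrices) maps positive semidefinite matrices to positive semidefinite
matrices. -/
def IsCompletelyPositive {d d' : ℕ}
    (Φ : Matrix (Fin d) (Fin d) ℂ → Matrix (Fin d') (Fin d') ℂ) : Prop :=
  ∀ (n : ℕ) (M : Matrix (Fin n × Fin d) (Fin n × Fin d) ℂ), M.PosSemidef →
    (Matrix.of fun (p q : Fin n × Fin d') =>
      Φ (Matrix.of fun i j => M (p.1, i) (q.1, j)) p.2 q.2).PosSemidef

/-- Partial trace over the first (ancilla) tensor factor. -/
noncomputable def ptraceA {a b : ℕ} (M : Matrix (Fin a × Fin b) (Fin a × Fin b) ℂ) :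
    Matrix (Fin b) (Fin b) ℂ :=
  Matrix.of fun i j => ∑ k, M (k, i) (k, j)

/-- `(id ⊗ C)`: apply `C` to the second (target) tensor factor. -/
noncomputable def idTensor {da dt dt' : ℕ}
    (C : Matrix (Fin dt) (Fin dt) ℂ → Matrix (Fin dt') (Fin dt') ℂ)
    (M : Matrix (Fin da × Fin dt) (Fin da × Fin dt) ℂ) :
    Matrix (Fin da × Fin dt') (Fin da × Fin dt') ℂ :=
  Matrix.of fun p q => C (Matrix.of fun i j => M (p.1, i) (q.1, j)) p.2 q.2

open Filter Topology in
/-- The sum `∑ w r log (s + t r)` loses the divergence `log t` and tends to `∑ w r log r`. -/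
theorem tendsto_sum_mul_log_add_mul {α : Type*} [Fintype α] (w r s : α → ℝ)
    (hr : ∀ a, 0 ≤ r a) (hs : ∀ a, 0 ≤ s a) :
    Tendsto (fun t : ℝ => ∑ a, w a * r a * Real.log (s a + t * r a) -
      (∑ a, w a * r a) * Real.log t) atTop (𝓝 (∑ a, w a * r a * Real.log (r a))) := by
  have key : Tendsto (fun t : ℝ => ∑ a, w a * r a * Real.log (s a * t⁻¹ + r a)) atTop
      (𝓝 (∑ a, w a * r a * Real.log (r a))) := by
    refine tendsto_finsetSum _ fun a _ => ?_
    rcases (hr a).eq_or_lt with h | h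
    · simp [← h]
    · refine Tendsto.const_mul _ (Tendsto.log ?_ h.ne')
      simpa using (tendsto_inv_atTop_zero.const_mul (s a)).add_const (r a)
  refine key.congr' ?_
  filter_upwards [eventually_gt_atTop 0] with t ht
  rw [Finset.sum_mul, ← Finset.sum_sub_distrib]
  refine Finset.sum_congr rfl fun a _ => ?_
  rcases (hr a).eq_or_lt with h | h
  · simp [← h]
  · have hpos : 0 < s a * t⁻¹ + r a := by have := hs a; positivity
    have : s a + t * r a = (s a * t⁻¹ + r a) * t := by field_simp
    rw [this, Real.log_mul hpos.ne' ht.ne']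
    ring

theorem hasDerivAt_sum_mul_log_add_mul {α : Type*} [Fintype α] (w r s : α → ℝ)
    (hr : ∀ a, 0 ≤ r a) (hs : ∀ a, 0 ≤ s a) (hsupp : ∀ a, s a = 0 → w a * r a = 0)
    {t : ℝ} (ht : 0 ≤ t) :
    HasDerivAt (fun t : ℝ => ∑ a, w a * r a * Real.log (s a + t * r a))
      (∑ a, w a * (r a ^ 2 / (s a + t * r a))) t := by
  refine HasDerivAt.fun_sum fun a _ => ?_
  rcases (hs a).eq_or_lt with h | h
  · rcases mul_eq_zero.1 (hsupp a h.symm) with h0 | h0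
    · simpa [h0] using hasDerivAt_const t (0 : ℝ)
    · simpa [h0] using hasDerivAt_const t (0 : ℝ)
  · have hpos : 0 < s a + t * r a := by have := hr a; positivity
    have := ((((hasDerivAt_id t).mul_const (r a)).const_add (s a)).log hpos.ne').const_mul
      (w a * r a)
    refine this.congr_deriv ?_
    simp only [id_eq]
    ring

/-- Comparing the resolvent sums `∑ w r² / (s + t r)` for all `t > 0` compares the
relative entropies `∑ w r (log r - log s)`. -/
theorem sum_mul_log_sub_log_le {α β : Type*} [Fintype α] [Fintype β]
    (w r s : α → ℝ) (w' r' s' : β → ℝ)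
    (hr : ∀ a, 0 ≤ r a) (hs : ∀ a, 0 ≤ s a) (hr' : ∀ b, 0 ≤ r' b) (hs' : ∀ b, 0 ≤ s' b)
    (hsupp : ∀ a, s a = 0 → w a * r a = 0) (hsupp' : ∀ b, s' b = 0 → w' b * r' b = 0)
    (htr : ∑ b, w' b * r' b = ∑ a, w a * r a)
    (hle : ∀ t : ℝ, 0 < t → ∑ b, w' b * (r' b ^ 2 / (s' b + t * r' b)) ≤
      ∑ a, w a * (r a ^ 2 / (s a + t * r a))) :
    ∑ b, w' b * r' b * (Real.log (r' b) - Real.log (s' b)) ≤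
      ∑ a, w a * r a * (Real.log (r a) - Real.log (s a)) := by
  have hderiv := fun (t : ℝ) (ht : 0 ≤ t) =>
    (hasDerivAt_sum_mul_log_add_mul w r s hr hs hsupp ht).sub
    (hasDerivAt_sum_mul_log_add_mul w' r' s' hr' hs' hsupp' ht)
  have hmono := monotoneOn_of_deriv_nonneg (convex_Ici (0 : ℝ))
    (fun t ht => (hderiv t ht).continuousAt.continuousWithinAt)
    (fun t ht => (hderiv t
      (by simpa using interior_subset ht)).differentiableAt.differentiableWithinAt)
    (fun t ht => by
      rw [interior_Ici, Set.mem_Ioi] at ht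
      rw [(hderiv t ht.le).deriv]
      exact sub_nonneg.2 (hle t ht))
  have hlim := (tendsto_sum_mul_log_add_mul w r s hr hs).sub
    (tendsto_sum_mul_log_add_mul w' r' s' hr' hs')
  have := ge_of_tendsto hlim (b := ∑ a, w a * r a * Real.log (s a) -
      ∑ b, w' b * r' b * Real.log (s' b)) (by
    filter_upwards [Filter.eventually_ge_atTop 0] with t ht
    have := hmono (Set.mem_Ici.2 le_rfl) (Set.mem_Ici.2 ht) ht
    simp only [Pi.sub_apply, zero_mul, add_zero] at this
    rw [htr]
    linarith)
  simp only [mul_sub, Finset.sum_sub_distrib]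
  linarith

/-- `A` is unitarily diagonalized by the columns of `U` with nonnegative eigenvalues `r`. -/
structure IsDiagonalization {N : Type*} [Fintype N] [DecidableEq N]
    (A U : Matrix N N ℂ) (r : N → ℝ) : Prop where
  conjTranspose_mul_self : Uᴴ * U = 1
  eq : A = U * diagonal (fun k => (r k : ℂ)) * Uᴴ
  nonneg : ∀ k, 0 ≤ r k

/-- The quadratic form in `X` whose supremum is
`⟨A ^ (1/2), (Δ + t)⁻¹ A ^ (1/2)⟩`, with `Δ` the relative modular operator of `B` and `A`. -/
noncomputable def modularForm {N : Type*} [Fintype N] (A B : Matrix N N ℂ) (t : ℝ)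
    (X : Matrix N N ℂ) : ℝ :=
  2 * (A * X).trace.re - (B * (X * Xᴴ)).trace.re - t * (A * (Xᴴ * X)).trace.re

/-- Squared overlaps of the columns of `U` with the columns of `V`. -/
noncomputable def overlap {N : Type*} [Fintype N] (U V : Matrix N N ℂ) (k l : N) : ℝ :=
  Complex.normSq ((Uᴴ * V) k l)

section
variable {N : Type*} [Fintype N] [DecidableEq N]

theorem IsDiagonalization.mul_conjTranspose_self {A U : Matrix N N ℂ} {r : N → ℝ}
    (h : IsDiagonalization A U r) : U * Uᴴ = 1 :=
  mul_eq_one_comm.1 h.conjTranspose_mul_self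

theorem IsDiagonalization.trace_mul {A U : Matrix N N ℂ} {r : N → ℝ}
    (h : IsDiagonalization A U r) (M : Matrix N N ℂ) :
    (A * M).trace = ∑ k, (r k : ℂ) * (Uᴴ * M * U) k k := by
  rw [h.eq, Matrix.mul_assoc, Matrix.mul_assoc, Matrix.trace_mul_comm, Matrix.mul_assoc]
  simp [Matrix.trace, Matrix.diagonal_mul]

theorem IsDiagonalization.conj_eq {A U : Matrix N N ℂ} {r : N → ℝ}
    (h : IsDiagonalization A U r) : Uᴴ * A * U = diagonal (fun k => (r k : ℂ)) := by
  rw [h.eq]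
  calc _ = (Uᴴ * U) * diagonal (fun k => (r k : ℂ)) * (Uᴴ * U) := by
        simp only [Matrix.mul_assoc]
    _ = _ := by simp [h.conjTranspose_mul_self]

theorem modularForm_eq_sum {A B U V : Matrix N N ℂ} {r s : N → ℝ}
    (hA : IsDiagonalization A U r) (hB : IsDiagonalization B V s) (t : ℝ) (X : Matrix N N ℂ) :
    modularForm A B t X = ∑ k, ∑ l,
      (2 * r k * ((Uᴴ * V) k l * (Vᴴ * X * U) l k).re -
        (s l + t * r k) * Complex.normSq ((Vᴴ * X * U) l k)) := by
  have h1 : (A * X).trace.re = ∑ k, ∑ l, r k * ((Uᴴ * V) k l * (Vᴴ * X * U) l k).re := by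
    have : Uᴴ * X * U = (Uᴴ * V) * (Vᴴ * X * U) := by
      calc _ = Uᴴ * (V * Vᴴ) * X * U := by rw [hB.mul_conjTranspose_self, Matrix.mul_one]
        _ = _ := by simp only [Matrix.mul_assoc]
    rw [hA.trace_mul, this]
    simp [Matrix.mul_apply (M := Uᴴ * V), Finset.mul_sum]
  have h2 : (B * (X * Xᴴ)).trace.re =
      ∑ k, ∑ l, s l * Complex.normSq ((Vᴴ * X * U) l k) := by
    have : Vᴴ * (X * Xᴴ) * V = (Vᴴ * X * U) * (Vᴴ * X * U)ᴴ := by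
      calc _ = Vᴴ * X * (U * Uᴴ) * Xᴴ * V := by
            rw [hA.mul_conjTranspose_self, Matrix.mul_one]; simp only [Matrix.mul_assoc]
        _ = _ := by simp [Matrix.mul_assoc]
    rw [hB.trace_mul, this, Finset.sum_comm]
    generalize Vᴴ * X * U = Z
    simp only [Matrix.mul_apply, Matrix.conjTranspose_apply, Complex.star_def, Complex.mul_conj,
      Finset.mul_sum, ← Complex.ofReal_mul, Complex.re_sum, Complex.ofReal_re]
  have h3 : (A * (Xᴴ * X)).trace.re =
      ∑ k, ∑ l, r k * Complex.normSq ((Vᴴ * X * U) l k) := by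
    have : Uᴴ * (Xᴴ * X) * U = (Vᴴ * X * U)ᴴ * (Vᴴ * X * U) := by
      calc _ = Uᴴ * Xᴴ * (V * Vᴴ) * X * U := by
            rw [hB.mul_conjTranspose_self, Matrix.mul_one]; simp only [Matrix.mul_assoc]
        _ = _ := by simp [Matrix.mul_assoc]
    rw [hA.trace_mul, this]
    generalize Vᴴ * X * U = Z
    simp only [Matrix.mul_apply, Matrix.conjTranspose_apply, Complex.star_def,
      ← Complex.normSq_eq_conj_mul_self, Finset.mul_sum, ← Complex.ofReal_mul, Complex.re_sum,
      Complex.ofReal_re]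
  rw [modularForm, h1, h2, h3]
  simp only [Finset.mul_sum, ← Finset.sum_sub_distrib]
  refine Finset.sum_congr rfl fun k _ => Finset.sum_congr rfl fun l _ => ?_
  ring

theorem modularForm_le {A B U V : Matrix N N ℂ} {r s : N → ℝ}
    (hA : IsDiagonalization A U r) (hB : IsDiagonalization B V s) {t : ℝ} (ht : 0 < t)
    (X : Matrix N N ℂ) :
    modularForm A B t X ≤ ∑ k, ∑ l, overlap U V k l * (r k ^ 2 / (s l + t * r k)) := by
  rw [modularForm_eq_sum hA hB]
  refine Finset.sum_le_sum fun k _ => Finset.sum_le_sum fun l _ => ?_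
  rw [overlap]
  generalize (Uᴴ * V) k l = u
  generalize (Vᴴ * X * U) l k = z
  have hr := hA.nonneg k
  have hs := hB.nonneg l
  rcases hr.eq_or_lt with h | h
  · simpa [← h] using mul_nonneg hs (Complex.normSq_nonneg z)
  · have hpos : 0 < s l + t * r k := by positivity
    rw [← mul_div_assoc, le_div_iff₀ hpos, Complex.normSq_apply, Complex.normSq_apply,
      Complex.mul_re]
    nlinarith [sq_nonneg ((s l + t * r k) * z.re - r k * u.re),
      sq_nonneg ((s l + t * r k) * z.im + r k * u.im)]

theorem exists_modularForm_eq {A B U V : Matrix N N ℂ} {r s : N → ℝ}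
    (hA : IsDiagonalization A U r) (hB : IsDiagonalization B V s) {t : ℝ} (ht : 0 < t) :
    ∃ X, modularForm A B t X = ∑ k, ∑ l, overlap U V k l * (r k ^ 2 / (s l + t * r k)) := by
  let Z : Matrix N N ℂ := Matrix.of fun l k =>
    ((r k / (s l + t * r k) : ℝ) : ℂ) * star ((Uᴴ * V) k l)
  have hZ : Vᴴ * (V * Z * Uᴴ) * U = Z := by
    calc _ = (Vᴴ * V) * Z * (Uᴴ * U) := by simp only [Matrix.mul_assoc]
      _ = _ := by simp [hA.conjTranspose_mul_self, hB.conjTranspose_mul_self]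
  refine ⟨V * Z * Uᴴ, ?_⟩
  rw [modularForm_eq_sum hA hB, hZ]
  refine Finset.sum_congr rfl fun k _ => Finset.sum_congr rfl fun l _ => ?_
  simp only [Z, Matrix.of_apply, overlap]
  generalize (Uᴴ * V) k l = u
  have hr := hA.nonneg k
  have hs := hB.nonneg l
  rcases hr.eq_or_lt with h | h
  · simp [← h]
  · have hpos : 0 < s l + t * r k := by positivity
    have h1 : u * (((r k / (s l + t * r k) : ℝ) : ℂ) * star u) =
        ((r k / (s l + t * r k) * Complex.normSq u : ℝ) : ℂ) := by
      rw [mul_left_comm, Complex.star_def, Complex.mul_conj, Complex.ofReal_mul]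
    rw [h1, Complex.ofReal_re, Complex.normSq_mul, Complex.normSq_ofReal, Complex.star_def,
      Complex.normSq_conj]
    field_simp
    ring

theorem sum_overlap_eq_one {U V : Matrix N N ℂ} (hU : Uᴴ * U = 1) (hV : Vᴴ * V = 1) (k : N) :
    ∑ l, overlap U V k l = 1 := by
  have h : (Uᴴ * V) * (Uᴴ * V)ᴴ = 1 := by
    calc _ = Uᴴ * (V * Vᴴ) * U := by simp [Matrix.mul_assoc]
      _ = 1 := by rw [mul_eq_one_comm.1 hV, Matrix.mul_one, hU]
  have := congrFun (congrFun h k) k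
  rw [Matrix.mul_apply] at this
  simp only [Matrix.conjTranspose_apply, Complex.star_def, Complex.mul_conj,
    Matrix.one_apply_eq] at this
  exact_mod_cast this

theorem sum_overlap_mul {A U V : Matrix N N ℂ} {r : N → ℝ}
    (hA : IsDiagonalization A U r) (l : N) :
    ∑ k, overlap U V k l * r k = ((Vᴴ * A * V) l l).re := by
  have : Vᴴ * A * V = (Uᴴ * V)ᴴ * (diagonal (fun k => (r k : ℂ)) * (Uᴴ * V)) := by
    rw [hA.eq]; simp [Matrix.mul_assoc]
  rw [this, Matrix.mul_apply, Complex.re_sum]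
  refine Finset.sum_congr rfl fun k _ => ?_
  rw [Matrix.diagonal_mul, Matrix.conjTranspose_apply, mul_left_comm, Complex.star_def,
    ← Complex.normSq_eq_conj_mul_self, ← Complex.ofReal_mul, Complex.ofReal_re, overlap, mul_comm]

/-- The Kadison–Schwarz inequality for a unital map in Kraus form, paired with a positive
semidefinite matrix. -/
theorem trace_kraus_schwarz {J : Type*} [Fintype J] {B : Matrix N N ℂ} (hB : B.PosSemidef)
    (K : J → Matrix N N ℂ) (hK : ∑ j, (K j)ᴴ * K j = 1) (Y : J → Matrix N N ℂ) :
    (B * ((∑ j, (K j)ᴴ * Y j * K j) * (∑ j, (K j)ᴴ * Y j * K j)ᴴ)).trace.re ≤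
      ∑ j, (K j * B * (K j)ᴴ * (Y j * (Y j)ᴴ)).trace.re := by
  set X := ∑ j, (K j)ᴴ * Y j * K j with hX
  have hXH : Xᴴ = ∑ j, (K j)ᴴ * (Y j)ᴴ * K j := by
    simp [hX, Matrix.conjTranspose_sum, Matrix.mul_assoc]
  let D : J → Matrix N N ℂ := fun j => (Y j)ᴴ * K j - K j * Xᴴ
  have hD : ∑ j, (D j)ᴴ * D j = ∑ j, (K j)ᴴ * (Y j * (Y j)ᴴ) * K j - X * Xᴴ := by
    have h1 : ∀ j, (D j)ᴴ * D j = (K j)ᴴ * (Y j * (Y j)ᴴ) * K j - ((K j)ᴴ * Y j * K j) * Xᴴ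
        - X * ((K j)ᴴ * (Y j)ᴴ * K j) + X * ((K j)ᴴ * K j) * Xᴴ := by
      intro j
      simp only [D, Matrix.conjTranspose_sub, Matrix.conjTranspose_mul,
        Matrix.conjTranspose_conjTranspose]
      noncomm_ring
    simp only [h1, Finset.sum_add_distrib, Finset.sum_sub_distrib, ← Finset.sum_mul,
      ← Finset.mul_sum, ← hX, ← hXH, hK]
    simp
  have hnn : 0 ≤ (B * ∑ j, (D j)ᴴ * D j).trace.re := by
    rw [Finset.mul_sum, Matrix.trace_sum, Complex.re_sum]
    refine Finset.sum_nonneg fun j _ => ?_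
    rw [← Matrix.mul_assoc, Matrix.trace_mul_comm, ← Matrix.mul_assoc]
    exact (Complex.le_def.1 (hB.mul_mul_conjTranspose_same (D j)).trace_nonneg).1
  rw [hD, Matrix.mul_sub, Matrix.trace_sub, Complex.sub_re, Finset.mul_sum, Matrix.trace_sum,
    Complex.re_sum] at hnn
  have h2 : ∀ j, (K j * B * (K j)ᴴ * (Y j * (Y j)ᴴ)).trace =
      (B * ((K j)ᴴ * (Y j * (Y j)ᴴ) * K j)).trace := by
    intro j
    rw [Matrix.mul_assoc, Matrix.mul_assoc, Matrix.trace_mul_comm]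
    simp only [Matrix.mul_assoc]
  simp only [h2]
  linarith

theorem sum_modularForm_kraus_le {ι κ : Type*} [Fintype ι] [Fintype κ] {A B : Matrix N N ℂ}
    (hA : A.PosSemidef) (hB : B.PosSemidef) (K : ι → κ → Matrix N N ℂ)
    (hK : ∑ i, ∑ m, (K i m)ᴴ * K i m = 1) {t : ℝ} (ht : 0 < t) (Y : ι → Matrix N N ℂ) :
    ∑ i, modularForm (∑ m, K i m * A * (K i m)ᴴ) (∑ m, K i m * B * (K i m)ᴴ) t (Y i) ≤
      modularForm A B t (∑ i, ∑ m, (K i m)ᴴ * Y i * K i m) := by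
  have hK' : ∑ j : ι × κ, (K j.1 j.2)ᴴ * K j.1 j.2 = 1 := by
    rw [Fintype.sum_prod_type, hK]
  have h1 := trace_kraus_schwarz hB (fun j : ι × κ => K j.1 j.2) hK' (fun j => Y j.1)
  have h2 := trace_kraus_schwarz hA (fun j : ι × κ => K j.1 j.2) hK' (fun j => (Y j.1)ᴴ)
  have h3 : (∑ j : ι × κ, (K j.1 j.2)ᴴ * (Y j.1)ᴴ * K j.1 j.2) =
      (∑ i, ∑ m, (K i m)ᴴ * Y i * K i m)ᴴ := by
    simp [Matrix.conjTranspose_sum, Matrix.mul_assoc, Fintype.sum_prod_type]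
  rw [h3] at h2
  simp only [Fintype.sum_prod_type, Matrix.conjTranspose_conjTranspose] at h1 h2
  have h4 : (A * ∑ i, ∑ m, (K i m)ᴴ * Y i * K i m).trace.re =
      ∑ i, ((∑ m, K i m * A * (K i m)ᴴ) * Y i).trace.re := by
    simp only [Finset.mul_sum, Finset.sum_mul, Matrix.trace_sum, Complex.re_sum]
    refine Finset.sum_congr rfl fun i _ => Finset.sum_congr rfl fun m _ => ?_
    rw [show K i m * A * (K i m)ᴴ * Y i = K i m * (A * (K i m)ᴴ * Y i) by
      simp only [Matrix.mul_assoc], Matrix.trace_mul_comm (K i m)]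
    simp only [Matrix.mul_assoc]
  have h5 := mul_le_mul_of_nonneg_left h2 ht.le
  simp only [modularForm, Finset.sum_sub_distrib, ← Finset.mul_sum, h4]
  simp only [Finset.sum_mul, Matrix.trace_sum, Complex.re_sum] at h1 h5 ⊢
  linarith

end

section
variable {N : Type*} [Fintype N] [DecidableEq N]

theorem Matrix.PosSemidef.exists_isDiagonalization {A : Matrix N N ℂ} (hA : A.PosSemidef) :
    ∃ U r, IsDiagonalization A U r := by
  refine ⟨hA.1.eigenvectorUnitary, hA.1.eigenvalues, ?_, ?_, hA.eigenvalues_nonneg⟩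
  · exact Unitary.coe_star_mul_self hA.1.eigenvectorUnitary
  · exact hA.1.spectral_theorem

theorem IsDiagonalization.posSemidef {A U : Matrix N N ℂ} {r : N → ℝ}
    (h : IsDiagonalization A U r) : A.PosSemidef := by
  rw [h.eq]
  refine PosSemidef.mul_mul_conjTranspose_same (PosSemidef.diagonal fun k => ?_) U
  simpa using h.nonneg k

theorem IsDiagonalization.vN_eq {A U : Matrix N N ℂ} {r : N → ℝ}
    (h : IsDiagonalization A U r) : vN A = ∑ k, Real.negMulLog (r k) := by
  have hA := h.posSemidef.1
  have h1 : A.charpoly.roots = Multiset.map (fun k => (r k : ℂ)) Finset.univ.val := by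
    rw [h.eq, Matrix.charpoly_mul_comm, ← Matrix.mul_assoc, h.conjTranspose_mul_self,
      Matrix.one_mul, Matrix.charpoly_diagonal, Polynomial.roots_prod]
    · simp
    · simp [Finset.prod_ne_zero_iff, Polynomial.X_sub_C_ne_zero]
  have h2 := congrArg (Multiset.map fun z : ℂ => Real.negMulLog z.re)
    (hA.roots_charpoly_eq_eigenvalues.symm.trans h1)
  have h3 := congrArg Multiset.sum h2
  simpa [vN, hA, Multiset.map_map, Function.comp_def] using h3

theorem IsDiagonalization.smul {A U : Matrix N N ℂ} {r : N → ℝ}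
    (h : IsDiagonalization A U r) {c : ℝ} (hc : 0 ≤ c) :
    IsDiagonalization ((c : ℂ) • A) U (fun k => c * r k) := by
  refine ⟨h.conjTranspose_mul_self, ?_, fun k => mul_nonneg hc (h.nonneg k)⟩
  have : diagonal (fun k => ((c * r k : ℝ) : ℂ)) = (c : ℂ) • diagonal (fun k => (r k : ℂ)) := by
    ext i j
    by_cases hij : i = j <;> simp [hij]
  rw [this, Matrix.mul_smul, Matrix.smul_mul, ← h.eq]

theorem IsDiagonalization.trace_eq {A U : Matrix N N ℂ} {r : N → ℝ}
    (h : IsDiagonalization A U r) : A.trace = ((∑ k, r k : ℝ) : ℂ) := by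
  have := h.trace_mul 1
  simpa [h.conjTranspose_mul_self] using this

theorem Matrix.PosSemidef.mul_vN_inv_smul {X : Matrix N N ℂ} (hX : X.PosSemidef) {p : ℝ}
    (hp : 0 < p) (htr : X.trace = p) :
    p * vN ((X.trace)⁻¹ • X) = vN X + p * Real.log p := by
  obtain ⟨U, r, h⟩ := hX.exists_isDiagonalization
  have hsum : ∑ k, r k = p := by
    have := h.trace_eq
    rw [htr] at this
    exact_mod_cast this.symm
  have h' := h.smul (inv_nonneg.2 hp.le)
  rw [htr, ← Complex.ofReal_inv, h'.vN_eq, h.vN_eq]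
  conv_rhs => rw [← hsum]
  rw [Finset.mul_sum, Finset.sum_mul, ← Finset.sum_add_distrib]
  refine Finset.sum_congr rfl fun k _ => ?_
  rw [hsum]
  rcases (h.nonneg k).eq_or_lt with h0 | h0
  · simp [← h0]
  · rw [Real.negMulLog, Real.negMulLog, Real.log_mul (inv_ne_zero hp.ne') h0.ne', Real.log_inv]
    field_simp
    ring

theorem vN_zero : vN (0 : Matrix N N ℂ) = 0 := by
  have h : IsDiagonalization (0 : Matrix N N ℂ) 1 (fun _ => 0) :=
    ⟨by simp, by simp, fun _ => le_rfl⟩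
  simp [h.vN_eq]

/-- The relative entropy of two diagonalized matrices. -/
noncomputable def relEntropySum (U V : Matrix N N ℂ) (r s : N → ℝ) : ℝ :=
  ∑ k, ∑ l, overlap U V k l * r k * (Real.log (r k) - Real.log (s l))

theorem relEntropySum_eq {A U V : Matrix N N ℂ} {r s : N → ℝ}
    (hA : IsDiagonalization A U r) (hV : Vᴴ * V = 1) :
    relEntropySum U V r s = -vN A - ∑ l, Real.log (s l) * ((Vᴴ * A * V) l l).re := by
  rw [hA.vN_eq]
  simp only [relEntropySum, mul_sub, Finset.sum_sub_distrib]
  congr 1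
  · rw [← Finset.sum_neg_distrib]
    refine Finset.sum_congr rfl fun k _ => ?_
    simp only [mul_assoc]
    rw [← Finset.sum_mul, sum_overlap_eq_one hA.conjTranspose_mul_self hV, Real.negMulLog]
    ring
  · rw [Finset.sum_comm]
    refine Finset.sum_congr rfl fun l _ => ?_
    rw [← sum_overlap_mul hA, ← Finset.sum_mul, mul_comm]

theorem sum_overlap_mul_eq_trace {A U V : Matrix N N ℂ} {r : N → ℝ}
    (hA : IsDiagonalization A U r) (hV : Vᴴ * V = 1) :
    ∑ k, ∑ l, overlap U V k l * r k = A.trace.re := by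
  simp only [← Finset.sum_mul, sum_overlap_eq_one hA.conjTranspose_mul_self hV, one_mul,
    hA.trace_eq, Complex.ofReal_re]

/-- Monotonicity of the relative entropy under a trace-preserving family of Kraus maps. -/
theorem sum_relEntropySum_kraus_le {ι κ : Type*} [Fintype ι] [Fintype κ]
    {A B U V : Matrix N N ℂ} {r s : N → ℝ}
    (hA : IsDiagonalization A U r) (hB : IsDiagonalization B V s)
    (hsupp : ∀ k l, s l = 0 → overlap U V k l * r k = 0)
    (K : ι → κ → Matrix N N ℂ) (hK : ∑ i, ∑ m, (K i m)ᴴ * K i m = 1)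
    {U' V' : ι → Matrix N N ℂ} {r' s' : ι → N → ℝ}
    (hA' : ∀ i, IsDiagonalization (∑ m, K i m * A * (K i m)ᴴ) (U' i) (r' i))
    (hB' : ∀ i, IsDiagonalization (∑ m, K i m * B * (K i m)ᴴ) (V' i) (s' i))
    (hsupp' : ∀ i k l, s' i l = 0 → overlap (U' i) (V' i) k l * r' i k = 0) :
    ∑ i, relEntropySum (U' i) (V' i) (r' i) (s' i) ≤ relEntropySum U V r s := by
  have h := sum_mul_log_sub_log_le
    (fun a : N × N => overlap U V a.1 a.2) (fun a => r a.1) (fun a => s a.2)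
    (fun b : ι × N × N => overlap (U' b.1) (V' b.1) b.2.1 b.2.2) (fun b => r' b.1 b.2.1)
    (fun b => s' b.1 b.2.2)
    (fun a => hA.nonneg _) (fun a => hB.nonneg _) (fun b => (hA' _).nonneg _)
    (fun b => (hB' _).nonneg _) (fun a => hsupp _ _) (fun b => hsupp' _ _ _)
  simp only [Fintype.sum_prod_type] at h
  refine h ?_ fun t ht => ?_
  · rw [sum_overlap_mul_eq_trace hA hB.conjTranspose_mul_self]
    simp only [sum_overlap_mul_eq_trace (hA' _) (hB' _).conjTranspose_mul_self]
    rw [← Complex.re_sum]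
    congr 1
    calc ∑ i, (∑ m, K i m * A * (K i m)ᴴ).trace
        = (A * ∑ i, ∑ m, (K i m)ᴴ * K i m).trace := by
          simp only [Finset.mul_sum, Matrix.trace_sum]
          refine Finset.sum_congr rfl fun i _ => Finset.sum_congr rfl fun m _ => ?_
          rw [Matrix.mul_assoc, Matrix.trace_mul_comm, Matrix.mul_assoc]
      _ = A.trace := by rw [hK, Matrix.mul_one]
  · choose Y hY using fun i => exists_modularForm_eq (hA' i) (hB' i) ht
    calc _ = ∑ i, modularForm (∑ m, K i m * A * (K i m)ᴴ) (∑ m, K i m * B * (K i m)ᴴ) t (Y i) :=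
          Finset.sum_congr rfl fun i _ => (hY i).symm
      _ ≤ _ := sum_modularForm_kraus_le hA.posSemidef hB.posSemidef K hK ht Y
      _ ≤ _ := modularForm_le hA hB ht _

end

section
open scoped Kronecker

theorem one_kronecker_mul_mul_apply {a b : ℕ} (L R : Matrix (Fin b) (Fin b) ℂ)
    (M : Matrix (Fin a × Fin b) (Fin a × Fin b) ℂ) (p q : Fin a × Fin b) :
    (((1 : Matrix (Fin a) (Fin a) ℂ) ⊗ₖ L) * M * ((1 : Matrix (Fin a) (Fin a) ℂ) ⊗ₖ R)) p q =
      (L * (Matrix.of fun i j => M (p.1, i) (q.1, j)) * R) p.2 q.2 := by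
  simp [Matrix.mul_apply, Fintype.sum_prod_type, Matrix.one_apply, Finset.sum_ite_eq,
    Finset.sum_ite_eq', ite_mul]

theorem ptraceA_eq_sum {a b : ℕ} (M : Matrix (Fin a × Fin b) (Fin a × Fin b) ℂ) :
    ptraceA M = ∑ k, Matrix.of fun i j => M (k, i) (k, j) := by
  ext i j
  simp [ptraceA, Matrix.sum_apply]

theorem trace_ptraceA {a b : ℕ} (M : Matrix (Fin a × Fin b) (Fin a × Fin b) ℂ) :
    (ptraceA M).trace = M.trace := by
  simp only [ptraceA, Matrix.trace, Matrix.diag_apply, Matrix.of_apply, Fintype.sum_prod_type]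
  exact Finset.sum_comm

theorem ptraceA_one_kronecker_mul_mul {a b : ℕ} (L R : Matrix (Fin b) (Fin b) ℂ)
    (M : Matrix (Fin a × Fin b) (Fin a × Fin b) ℂ) :
    ptraceA (((1 : Matrix (Fin a) (Fin a) ℂ) ⊗ₖ L) * M * ((1 : Matrix (Fin a) (Fin a) ℂ) ⊗ₖ R)) =
      L * ptraceA M * R := by
  rw [ptraceA_eq_sum M, Finset.mul_sum, Finset.sum_mul]
  ext i j
  simp [ptraceA, one_kronecker_mul_mul_apply, Matrix.sum_apply]

theorem Matrix.PosSemidef.ptraceA {a b : ℕ} {M : Matrix (Fin a × Fin b) (Fin a × Fin b) ℂ}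
    (hM : M.PosSemidef) : (ptraceA M).PosSemidef := by
  rw [ptraceA_eq_sum]
  exact Matrix.posSemidef_sum _ fun k _ => hM.submatrix (fun i => (k, i))

theorem ptraceA_idTensor {a b : ℕ} {C : Matrix (Fin b) (Fin b) ℂ → Matrix (Fin b) (Fin b) ℂ}
    (hC : IsLinearMap ℂ C) (M : Matrix (Fin a × Fin b) (Fin a × Fin b) ℂ) :
    ptraceA (idTensor C M) = C (ptraceA M) := by
  rw [ptraceA_eq_sum M, ← hC.mk'_apply, map_sum]
  ext i j
  simp [ptraceA, idTensor, Matrix.sum_apply]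

/-- A completely positive linear map has a Kraus decomposition. -/
theorem IsCompletelyPositive.exists_kraus {d : ℕ}
    {C : Matrix (Fin d) (Fin d) ℂ → Matrix (Fin d) (Fin d) ℂ} (hlin : IsLinearMap ℂ C)
    (hC : IsCompletelyPositive C) :
    ∃ K : Fin d × Fin d → Matrix (Fin d) (Fin d) ℂ, ∀ M, C M = ∑ m, K m * M * (K m)ᴴ := by
  let v : Fin d × Fin d → ℂ := fun p => if p.1 = p.2 then 1 else 0
  have hblock : ∀ a b : Fin d, (Matrix.of fun i j => vecMulVec v (star v) (a, i) (b, j)) =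
      Matrix.single a b (1 : ℂ) := by
    intro a b
    ext i j
    by_cases h1 : a = i <;> by_cases h2 : b = j <;> simp [v, vecMulVec_apply, Matrix.single, h1, h2]
  have hJ := hC d _ (posSemidef_vecMulVec_self_star v)
  simp only [hblock] at hJ
  obtain ⟨U, r, h⟩ := hJ.exists_isDiagonalization
  refine ⟨fun m => Matrix.of fun p a => (Real.sqrt (r m) : ℂ) * U (a, p) m, fun M => ?_⟩
  have hM : C M = ∑ a, ∑ b, M a b • C (Matrix.single a b 1) := by
    conv_lhs => rw [Matrix.matrix_eq_sum_single M]
    rw [← hlin.mk'_apply, map_sum]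
    refine Finset.sum_congr rfl fun a _ => ?_
    rw [map_sum]
    refine Finset.sum_congr rfl fun b _ => ?_
    rw [← hlin.mk'_apply, ← map_smul]
    simp
  have hent : ∀ a b p q, C (Matrix.single a b 1) p q =
      ∑ m, U (a, p) m * (r m : ℂ) * star (U (b, q) m) := by
    intro a b p q
    have := congrFun (congrFun h.eq (a, p)) (b, q)
    rw [Matrix.mul_apply] at this
    simpa only [Matrix.of_apply, Matrix.mul_diagonal, Matrix.conjTranspose_apply] using this
  ext p q
  have hsq : ∀ m, (Real.sqrt (r m) : ℂ) * (Real.sqrt (r m) : ℂ) = (r m : ℂ) := fun m => by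
    rw [← Complex.ofReal_mul, Real.mul_self_sqrt (h.nonneg m)]
  simp only [hM, Matrix.sum_apply, Matrix.smul_apply, hent, Matrix.mul_apply, Matrix.of_apply,
    Matrix.conjTranspose_apply, smul_eq_mul, Finset.mul_sum, Finset.sum_mul, star_mul',
    Complex.star_def, Complex.conj_ofReal, ← hsq]
  rw [Finset.sum_comm]
  refine Eq.trans ?_ Finset.sum_comm
  refine Finset.sum_congr rfl fun b _ => Eq.trans ?_ Finset.sum_comm
  refine Finset.sum_congr rfl fun a _ => Finset.sum_congr rfl fun m _ => ?_
  ring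

theorem sum_conjTranspose_mul_eq_one {ι κ : Type*} [Fintype ι] [Fintype κ] {N : Type*}
    [Fintype N] [DecidableEq N] {C : ι → Matrix N N ℂ → Matrix N N ℂ}
    (hTP : ∀ M : Matrix N N ℂ, (∑ i, C i M).trace = M.trace) {K : ι → κ → Matrix N N ℂ}
    (hK : ∀ i M, C i M = ∑ m, K i m * M * (K i m)ᴴ) :
    ∑ i, ∑ m, (K i m)ᴴ * K i m = 1 := by
  refine Matrix.ext_iff_trace_mul_left.2 fun M => ?_
  rw [Matrix.mul_one, ← hTP M]
  simp only [hK, Finset.mul_sum, Matrix.trace_sum]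
  refine Finset.sum_congr rfl fun i _ => Finset.sum_congr rfl fun m _ => ?_
  rw [← Matrix.mul_assoc, Matrix.trace_mul_comm, Matrix.mul_assoc]

theorem idTensor_eq_sum_kraus {a b : ℕ} {κ : Type*} [Fintype κ]
    {C : Matrix (Fin b) (Fin b) ℂ → Matrix (Fin b) (Fin b) ℂ} {K : κ → Matrix (Fin b) (Fin b) ℂ}
    (hK : ∀ M, C M = ∑ m, K m * M * (K m)ᴴ) (M : Matrix (Fin a × Fin b) (Fin a × Fin b) ℂ) :
    idTensor C M = ∑ m, ((1 : Matrix (Fin a) (Fin a) ℂ) ⊗ₖ K m) * M *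
      ((1 : Matrix (Fin a) (Fin a) ℂ) ⊗ₖ K m)ᴴ := by
  ext p q
  simp only [idTensor, Matrix.of_apply, hK, Matrix.sum_apply, Matrix.conjTranspose_kronecker,
    Matrix.conjTranspose_one, one_kronecker_mul_mul_apply]

theorem IsDiagonalization.one_kronecker {a b : ℕ} {T V : Matrix (Fin b) (Fin b) ℂ}
    {s : Fin b → ℝ} (h : IsDiagonalization T V s) :
    IsDiagonalization ((1 : Matrix (Fin a) (Fin a) ℂ) ⊗ₖ T) ((1 : Matrix (Fin a) (Fin a) ℂ) ⊗ₖ V)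
      (fun p => s p.2) := by
  have hd : diagonal (fun p : Fin a × Fin b => (s p.2 : ℂ)) =
      (1 : Matrix (Fin a) (Fin a) ℂ) ⊗ₖ diagonal (fun k => (s k : ℂ)) := by
    rw [← Matrix.diagonal_one, Matrix.diagonal_kronecker_diagonal]
    simp
  refine ⟨?_, ?_, fun p => h.nonneg _⟩
  · rw [Matrix.conjTranspose_kronecker, Matrix.conjTranspose_one, ← Matrix.mul_kronecker_mul,
      h.conjTranspose_mul_self, Matrix.mul_one, Matrix.one_kronecker_one]
  · rw [hd, Matrix.conjTranspose_kronecker, Matrix.conjTranspose_one, ← Matrix.mul_kronecker_mul,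
      ← Matrix.mul_kronecker_mul, ← h.eq, Matrix.mul_one, Matrix.mul_one]

theorem sum_conj_one_kronecker_diag {a b : ℕ} {A : Matrix (Fin a × Fin b) (Fin a × Fin b) ℂ}
    {V : Matrix (Fin b) (Fin b) ℂ} {s : Fin b → ℝ} (hV : IsDiagonalization (ptraceA A) V s)
    (l : Fin b) :
    ∑ c, ((((1 : Matrix (Fin a) (Fin a) ℂ) ⊗ₖ V)ᴴ * A *
      ((1 : Matrix (Fin a) (Fin a) ℂ) ⊗ₖ V)) (c, l) (c, l)).re = s l := by
  have h := ptraceA_one_kronecker_mul_mul Vᴴ V A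
  rw [hV.conj_eq] at h
  have h' := congrArg Complex.re (congrFun (congrFun h l) l)
  simpa [ptraceA, Matrix.conjTranspose_kronecker] using h'

theorem overlap_mul_eq_zero_of_ptraceA {a b : ℕ}
    {A U : Matrix (Fin a × Fin b) (Fin a × Fin b) ℂ} {r : Fin a × Fin b → ℝ}
    {V : Matrix (Fin b) (Fin b) ℂ} {s : Fin b → ℝ} (hA : IsDiagonalization A U r)
    (hV : IsDiagonalization (ptraceA A) V s) (k l : Fin a × Fin b) (hl : s l.2 = 0) :
    overlap U ((1 : Matrix (Fin a) (Fin a) ℂ) ⊗ₖ V) k l * r k = 0 := by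
  have hnn : ∀ k l, 0 ≤ overlap U ((1 : Matrix (Fin a) (Fin a) ℂ) ⊗ₖ V) k l * r k :=
    fun k l => mul_nonneg (Complex.normSq_nonneg _) (hA.nonneg k)
  have h := sum_conj_one_kronecker_diag hV l.2
  simp only [hl, ← sum_overlap_mul hA] at h
  have h1 := (Finset.sum_eq_zero_iff_of_nonneg
    (fun c _ => Finset.sum_nonneg fun k _ => hnn k (c, l.2))).1 h l.1 (Finset.mem_univ _)
  exact (Finset.sum_eq_zero_iff_of_nonneg (fun k _ => hnn k l)).1 h1 k (Finset.mem_univ _)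

theorem relEntropySum_one_kronecker {a b : ℕ}
    {A U : Matrix (Fin a × Fin b) (Fin a × Fin b) ℂ} {r : Fin a × Fin b → ℝ}
    {V : Matrix (Fin b) (Fin b) ℂ} {s : Fin b → ℝ} (hA : IsDiagonalization A U r)
    (hV : IsDiagonalization (ptraceA A) V s) :
    relEntropySum U ((1 : Matrix (Fin a) (Fin a) ℂ) ⊗ₖ V) r (fun p => s p.2) =
      -vN A + vN (ptraceA A) := by
  rw [relEntropySum_eq hA (hV.one_kronecker (a := a)).conjTranspose_mul_self,
    Fintype.sum_prod_type_right]
  simp only [← Finset.mul_sum, sum_conj_one_kronecker_diag hV]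
  rw [hV.vN_eq, sub_eq_add_neg, ← Finset.sum_neg_distrib]
  congr 1
  refine Finset.sum_congr rfl fun l _ => ?_
  rw [Real.negMulLog]
  ring

/-- The conditional entropy given the target does not decrease under a measurement of the target. -/
theorem sum_vN_ptraceA_sub_vN_le {a b : ℕ} {ι κ : Type*} [Fintype ι] [Fintype κ]
    {A : Matrix (Fin a × Fin b) (Fin a × Fin b) ℂ} (hA : A.PosSemidef)
    {C : ι → Matrix (Fin b) (Fin b) ℂ → Matrix (Fin b) (Fin b) ℂ}
    (hlin : ∀ i, IsLinearMap ℂ (C i)) {K : ι → κ → Matrix (Fin b) (Fin b) ℂ}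
    (hCK : ∀ i M, C i M = ∑ m, K i m * M * (K i m)ᴴ)
    (hK : ∑ i, ∑ m, (K i m)ᴴ * K i m = 1) :
    ∑ i, (-vN (idTensor (C i) A) + vN (C i (ptraceA A))) ≤ -vN A + vN (ptraceA A) := by
  have hX : ∀ i, (idTensor (C i) A).PosSemidef := fun i => by
    rw [idTensor_eq_sum_kraus (hCK i)]
    exact Matrix.posSemidef_sum _ fun m _ => hA.mul_mul_conjTranspose_same _
  obtain ⟨U, r, hU⟩ := hA.exists_isDiagonalization
  obtain ⟨V, s, hV⟩ := hA.ptraceA.exists_isDiagonalization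
  choose U' r' hU' using fun i => (hX i).exists_isDiagonalization
  choose V' s' hV' using fun i => (hX i).ptraceA.exists_isDiagonalization
  have h := sum_relEntropySum_kraus_le hU (hV.one_kronecker (a := a))
    (overlap_mul_eq_zero_of_ptraceA hU hV)
    (fun i m => (1 : Matrix (Fin a) (Fin a) ℂ) ⊗ₖ K i m) (U' := U') (r' := r')
    (V' := fun i => (1 : Matrix (Fin a) (Fin a) ℂ) ⊗ₖ V' i) (s' := fun i p => s' i p.2)
    (by
      simp only [Matrix.conjTranspose_kronecker, Matrix.conjTranspose_one,
        ← Matrix.mul_kronecker_mul, Matrix.mul_one]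
      ext p q
      have := congrFun (congrFun hK p.2) q.2
      simp only [Matrix.sum_apply, Matrix.kroneckerMap_apply, ← Finset.mul_sum] at this ⊢
      rw [this, ← Matrix.kroneckerMap_apply (· * ·) (1 : Matrix (Fin a) (Fin a) ℂ) 1 p q,
        Matrix.one_kronecker_one])
    (fun i => by
      rw [← idTensor_eq_sum_kraus (hCK i)]
      exact hU' i)
    (fun i => by
      convert (hV' i).one_kronecker (a := a) using 1
      rw [ptraceA_idTensor (hlin i), hCK]
      simp only [Matrix.conjTranspose_kronecker, Matrix.conjTranspose_one,
        ← Matrix.mul_kronecker_mul, Matrix.mul_one]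
      ext p q
      simp only [Matrix.sum_apply, Matrix.kroneckerMap_apply, ← Finset.mul_sum])
    (fun i => overlap_mul_eq_zero_of_ptraceA (hU' i) (hV' i))
  simp only [relEntropySum_one_kronecker hU hV,
    fun i => relEntropySum_one_kronecker (hU' i) (hV' i), ptraceA_idTensor (hlin _)] at h
  exact h

end

/-- The work benefit of a measurement is determined by the target system alone:
the entropy reduction achieved on a joint state of an ancilla and the target is
at most the entropy reduction achieved on the target marginal. -/
theorem measurement_work_benefit_target_only {da dt n : ℕ}
    (ρs : Matrix (Fin da × Fin dt) (Fin da × Fin dt) ℂ) (hρs : IsDensityMatrix ρs)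
    (C : Fin n → Matrix (Fin dt) (Fin dt) ℂ → Matrix (Fin dt) (Fin dt) ℂ)
    (hlin : ∀ i, IsLinearMap ℂ (C i))
    (hCP : ∀ i, IsCompletelyPositive (C i))
    (hTP : ∀ M : Matrix (Fin dt) (Fin dt) ℂ, (∑ i, C i M).trace = M.trace)
    (ρt : Matrix (Fin dt) (Fin dt) ℂ) (hρt : ρt = ptraceA ρs)
    (p : Fin n → ℝ) (hp : ∀ i, p i = ((idTensor (C i) ρs).trace).re) :
    vN ρs - ∑ i ∈ Finset.univ.filter (fun i => 0 < p i),
        p i * vN (((idTensor (C i) ρs).trace)⁻¹ • idTensor (C i) ρs)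
      ≤ vN ρt - ∑ i ∈ Finset.univ.filter (fun i => 0 < p i),
        p i * vN (((C i ρt).trace)⁻¹ • C i ρt) := by
  choose K hCK using fun i => (hCP i).exists_kraus (hlin i)
  have hmain := sum_vN_ptraceA_sub_vN_le hρs.1 hlin hCK (sum_conjTranspose_mul_eq_one hTP hCK)
  subst hρt
  have hX : ∀ i, (idTensor (C i) ρs).PosSemidef := fun i => by
    rw [idTensor_eq_sum_kraus (hCK i)]
    exact Matrix.posSemidef_sum _ fun m _ => hρs.1.mul_mul_conjTranspose_same _
  have hT : ∀ i, (C i (ptraceA ρs)).PosSemidef := fun i => by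
    rw [← ptraceA_idTensor (hlin i)]
    exact (hX i).ptraceA
  have htrT : ∀ i, (C i (ptraceA ρs)).trace = (idTensor (C i) ρs).trace := fun i => by
    rw [← ptraceA_idTensor (hlin i), trace_ptraceA]
  have htr : ∀ i, (idTensor (C i) ρs).trace = p i := fun i => by
    rw [hp]
    exact Complex.ext rfl (Complex.le_def.1 (hX i).trace_nonneg).2.symm
  have hterm : ∀ i, (if 0 < p i then
        p i * vN (((C i (ptraceA ρs)).trace)⁻¹ • C i (ptraceA ρs)) else 0) -
      (if 0 < p i then p i * vN (((idTensor (C i) ρs).trace)⁻¹ • idTensor (C i) ρs) else 0) =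
      -vN (idTensor (C i) ρs) + vN (C i (ptraceA ρs)) := by
    intro i
    split_ifs with h
    · rw [(hX i).mul_vN_inv_smul h (htr i), (hT i).mul_vN_inv_smul h ((htrT i).trans (htr i))]
      ring
    · have h0 : p i = 0 := by
        refine le_antisymm (not_lt.1 h) ?_
        rw [hp]
        exact (Complex.le_def.1 (hX i).trace_nonneg).1
      have hX0 : idTensor (C i) ρs = 0 := (hX i).trace_eq_zero_iff.1 (by rw [htr, h0]; simp)
      have hT0 : C i (ptraceA ρs) = 0 :=
        (hT i).trace_eq_zero_iff.1 (by rw [htrT, htr, h0]; simp)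
      simp [hX0, hT0, vN_zero]
  rw [Finset.sum_filter, Finset.sum_filter]
  simp only [← hterm, Finset.sum_sub_distrib] at hmain
  linarith
end

section
/- Any non-trivial post-selected measurement yields a work benefit that grows without bound in the ancilla dimension: let H_t be a Hermitian d_t×d_t matrix with smallest and largest eigenvalues E_min and E_max, let T > 0, and let M be a positive semidefinite d_t×d_t matrix with M ≤ I whose largest and smallest eigenvalues satisfy λ_max > λ_min, with corresponding orthonormal eigenvectors u and v. Let C_succ be a completely positive linear map on d_t×d_t matrices satisfying Tr[C_succ(X)] = Tr[M X] for all X. For any d_a ≥ 1 and unit vector φ ∈ ℂ^{d_a}, set ρ_s = (1/2)|u⟩⟨u| ⊗ |φ⟩⟨φ| + (1/2)|v⟩⟨v| ⊗ (I/d_a) on ℂ^{d_t} ⊗ ℂ^{d_a}, ρ_t = (1/2)(|u⟩⟨u| + |v⟩⟨v|), p_succ = (λ_max + λ_min)/2, σ_{s,succ} = (C_succ ⊗ id)(ρ_s)/p_succ, and q = λ_min/(λ_max + λ_min). Then the conditional work benefit W = Tr[C_succ((H_t ρ_t + ρ_t H_t)/2)]/p_succ − Tr[H_t ρ_t] + T·(S(ρ_s)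 − S(σ_{s,succ})) satisfies W ≥ E_min − E_max + T·((1/2 − q)·log d_a − log d_t); since q < 1/2, this lower bound tends to +∞ as d_a → ∞. -/
open scoped ComplexOrder Kronecker
open Matrix

/-- `(C ⊗ id)`: apply `C` to the first (target) tensor factor. -/
noncomputable def tensorId {dt dt' da : ℕ}
    (C : Matrix (Fin dt) (Fin dt) ℂ → Matrix (Fin dt') (Fin dt') ℂ)
    (M : Matrix (Fin dt × Fin da) (Fin dt × Fin da) ℂ) :
    Matrix (Fin dt' × Fin da) (Fin dt' × Fin da) ℂ :=
  Matrix.of fun p q => C (Matrix.of fun i j => M (i, p.2) (j, q.2)) p.1 q.1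

namespace Matrix.IsHermitian

variable {ι : Type*} [Fintype ι] [DecidableEq ι] {A : Matrix ι ι ℂ}

/-- The (real part of the) diagonal entry `⟨wₖ|X|wₖ⟩` of `X` in the eigenbasis `w` of `A`. -/
noncomputable def eigenWeight (hA : A.IsHermitian) (X : Matrix ι ι ℂ) (k : ι) : ℝ :=
  ((star (hA.eigenvectorUnitary : Matrix ι ι ℂ) * X * hA.eigenvectorUnitary) k k).re

lemma eigenWeight_add (hA : A.IsHermitian) (X Y : Matrix ι ι ℂ) (k : ι) :
    hA.eigenWeight (X + Y) k = hA.eigenWeight X k + hA.eigenWeight Y k := by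
  simp [eigenWeight, mul_add, add_mul]

lemma eigenWeight_sub (hA : A.IsHermitian) (X Y : Matrix ι ι ℂ) (k : ι) :
    hA.eigenWeight (X - Y) k = hA.eigenWeight X k - hA.eigenWeight Y k := by
  simp [eigenWeight, mul_sub, sub_mul]

lemma eigenWeight_smul (hA : A.IsHermitian) (r : ℝ) (X : Matrix ι ι ℂ) (k : ι) :
    hA.eigenWeight ((r : ℂ) • X) k = r * hA.eigenWeight X k := by
  simp [eigenWeight]

lemma eigenWeight_one (hA : A.IsHermitian) (k : ι) : hA.eigenWeight 1 k = 1 := by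
  simp [eigenWeight]

lemma eigenWeight_nonneg (hA : A.IsHermitian) {X : Matrix ι ι ℂ} (hX : X.PosSemidef) (k : ι) :
    0 ≤ hA.eigenWeight X k :=
  (Complex.nonneg_iff.mp (hX.conjTranspose_mul_mul_same
    (hA.eigenvectorUnitary : Matrix ι ι ℂ)).diag_nonneg).1

lemma sum_eigenWeight (hA : A.IsHermitian) (X : Matrix ι ι ℂ) :
    ∑ k, hA.eigenWeight X k = X.trace.re := by
  have h : (star (hA.eigenvectorUnitary : Matrix ι ι ℂ) * X * hA.eigenvectorUnitary).trace
      = X.trace := by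
    rw [trace_mul_comm, ← mul_assoc, Unitary.mul_star_self_of_mem hA.eigenvectorUnitary.2, one_mul]
  rw [← h, trace, Complex.re_sum]
  rfl

lemma eigenWeight_mul_self (hA : A.IsHermitian) (X : Matrix ι ι ℂ) (k : ι) :
    hA.eigenWeight (X * A) k = hA.eigenvalues k * hA.eigenWeight X k := by
  have h : A * (hA.eigenvectorUnitary : Matrix ι ι ℂ) =
      (hA.eigenvectorUnitary : Matrix ι ι ℂ) * diagonal (RCLike.ofReal ∘ hA.eigenvalues) := by
    rw [← hA.conjStarAlgAut_star_eigenvectorUnitary, Unitary.conjStarAlgAut_star_apply,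
      ← mul_assoc, ← mul_assoc, Unitary.mul_star_self_of_mem hA.eigenvectorUnitary.2, one_mul]
  rw [eigenWeight, mul_assoc, mul_assoc, h, ← mul_assoc, ← mul_assoc, mul_diagonal]
  simp [eigenWeight, mul_comm]

lemma eigenWeight_self (hA : A.IsHermitian) (k : ι) :
    hA.eigenWeight A k = hA.eigenvalues k := by
  simpa [eigenWeight_one] using hA.eigenWeight_mul_self 1 k

lemma sum_eigenvalues_mul_eigenWeight (hA : A.IsHermitian) (X : Matrix ι ι ℂ) :
    ∑ k, hA.eigenvalues k * hA.eigenWeight X k = (X * A).trace.re := by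
  simp_rw [← eigenWeight_mul_self, sum_eigenWeight]

lemma le_trace_mul_re (hA : A.IsHermitian) {m : ℝ} (hm : ∀ k, m ≤ hA.eigenvalues k)
    {X : Matrix ι ι ℂ} (hX : X.PosSemidef) : m * X.trace.re ≤ (X * A).trace.re := by
  rw [← hA.sum_eigenvalues_mul_eigenWeight, ← hA.sum_eigenWeight, Finset.mul_sum]
  exact Finset.sum_le_sum fun k _ =>
    mul_le_mul_of_nonneg_right (hm k) (hA.eigenWeight_nonneg hX k)

lemma trace_mul_re_le (hA : A.IsHermitian) {m : ℝ} (hm : ∀ k, hA.eigenvalues k ≤ m)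
    {X : Matrix ι ι ℂ} (hX : X.PosSemidef) : (X * A).trace.re ≤ m * X.trace.re := by
  rw [← hA.sum_eigenvalues_mul_eigenWeight, ← hA.sum_eigenWeight, Finset.mul_sum]
  exact Finset.sum_le_sum fun k _ =>
    mul_le_mul_of_nonneg_right (hm k) (hA.eigenWeight_nonneg hX k)

end Matrix.IsHermitian

lemma Real.negMulLog_le_sub_sub_mul_log {s t : ℝ} (hs : 0 ≤ s) (ht : 0 < t) :
    Real.negMulLog s ≤ t - s - s * Real.log t := by
  rcases hs.eq_or_lt with rfl | hs
  · simpa using ht.le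
  · have h := mul_le_mul_of_nonneg_left (Real.log_le_sub_one_of_pos (div_pos ht hs)) hs.le
    rw [Real.log_div ht.ne' hs.ne', mul_sub, mul_sub, mul_div_cancel₀ _ hs.ne'] at h
    rw [Real.negMulLog]
    linarith

/-- Klein's inequality for the reference operator `a P + b (1 - P)`. -/
lemma vN_le_of_posSemidef {ι : Type*} [Fintype ι] [DecidableEq ι] {σ P : Matrix ι ι ℂ}
    (hσ : σ.PosSemidef) (hP : P.PosSemidef) (hP' : (1 - P).PosSemidef) {a b : ℝ}
    (ha : 0 < a) (hb : 0 < b)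
    (htr : a * P.trace.re + b * (1 - P).trace.re ≤ σ.trace.re) :
    vN σ ≤ -(Real.log a * (P * σ).trace.re + Real.log b * ((1 - P) * σ).trace.re) := by
  rw [vN, dif_pos hσ.1]
  have hσ1 := hσ.1
  have key : ∀ k, Real.negMulLog (hσ1.eigenvalues k) ≤
      (a * hσ1.eigenWeight P k + b * hσ1.eigenWeight (1 - P) k) - hσ1.eigenvalues k -
      (Real.log a * (hσ1.eigenvalues k * hσ1.eigenWeight P k) +
        Real.log b * (hσ1.eigenvalues k * hσ1.eigenWeight (1 - P) k)) := by
    intro k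
    have hs := hσ.eigenvalues_nonneg k
    have hx := hσ1.eigenWeight_nonneg hP k
    have hy := hσ1.eigenWeight_nonneg hP' k
    have hxy : hσ1.eigenWeight P k + hσ1.eigenWeight (1 - P) k = 1 := by
      rw [← hσ1.eigenWeight_add, add_sub_cancel, hσ1.eigenWeight_one]
    have hconc := strictConcaveOn_log_Ioi.concaveOn.2 (Set.mem_Ioi.2 ha) (Set.mem_Ioi.2 hb)
      hx hy hxy
    have hpos := (convex_Ioi (0 : ℝ)) (Set.mem_Ioi.2 ha) (Set.mem_Ioi.2 hb) hx hy hxy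
    simp only [smul_eq_mul, Set.mem_Ioi] at hconc hpos
    have h1 := Real.negMulLog_le_sub_sub_mul_log hs hpos
    have h2 := mul_le_mul_of_nonneg_left hconc hs
    linarith
  refine (Finset.sum_le_sum fun k _ => key k).trans ?_
  have htrσ : ∑ k, hσ1.eigenvalues k = σ.trace.re := by
    simp_rw [← hσ1.eigenWeight_self, hσ1.sum_eigenWeight]
  simp only [Finset.sum_sub_distrib, Finset.sum_add_distrib, ← Finset.mul_sum,
    hσ1.sum_eigenvalues_mul_eigenWeight, hσ1.sum_eigenWeight, htrσ]
  linarith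

/-- The entropy of a matrix all of whose eigenvalues lie in `{0, a, b}`, where `c₀ + c₁ x`
interpolates `-log x` at `a` and `b`. -/
lemma vN_eq_of_mul_self_mul_self {ι : Type*} [Fintype ι] [DecidableEq ι] {ρ : Matrix ι ι ℂ}
    (hρ : ρ.IsHermitian) {a b c₀ c₁ : ℝ} (ha : -Real.log a = c₀ + c₁ * a)
    (hb : -Real.log b = c₀ + c₁ * b)
    (hpoly : ρ * ρ * ρ + ((a * b : ℝ) : ℂ) • ρ = ((a + b : ℝ) : ℂ) • (ρ * ρ)) :
    vN ρ = c₀ * ρ.trace.re + c₁ * (ρ * ρ).trace.re := by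
  rw [vN, dif_pos hρ, ← hρ.sum_eigenWeight, ← hρ.sum_eigenWeight, Finset.mul_sum,
    Finset.mul_sum, ← Finset.sum_add_distrib]
  refine Finset.sum_congr rfl fun k _ => ?_
  have h := congrArg (hρ.eigenWeight · k) hpoly
  simp only [hρ.eigenWeight_add, hρ.eigenWeight_smul, hρ.eigenWeight_mul_self,
    hρ.eigenWeight_self] at h ⊢
  have h' : hρ.eigenvalues k * ((hρ.eigenvalues k - a) * (hρ.eigenvalues k - b)) = 0 := by
    linear_combination h
  rw [Real.negMulLog]
  rcases mul_eq_zero.mp h' with h0 | h0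
  · simp [h0]
  rcases mul_eq_zero.mp h0 with h0 | h0
  · rw [sub_eq_zero.mp h0]; linear_combination a * ha
  · rw [sub_eq_zero.mp h0]; linear_combination b * hb

lemma vN_half_add_half {ι : Type*} [Fintype ι] [DecidableEq ι] {A B : Matrix ι ι ℂ}
    (hA : A.IsHermitian) (hB : B.IsHermitian) {n : ℝ} (hn : 0 < n)
    (hAA : A * A = A) (hAB : A * B = 0) (hBA : B * A = 0) (hBB : B * B = (n : ℂ)⁻¹ • B)
    (htA : A.trace = 1) (htB : B.trace = 1) :
    vN ((2 : ℂ)⁻¹ • A + (2 : ℂ)⁻¹ • B) = Real.log 2 + 1 / 2 * Real.log n := by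
  have hn' : (n : ℂ) ≠ 0 := by exact_mod_cast hn.ne'
  have hsq : ((2 : ℂ)⁻¹ • A + (2 : ℂ)⁻¹ • B) * ((2 : ℂ)⁻¹ • A + (2 : ℂ)⁻¹ • B) =
      (4 : ℂ)⁻¹ • A + (4 * n : ℂ)⁻¹ • B := by
    simp only [add_mul, mul_add, smul_mul_assoc, mul_smul_comm, hAA, hAB, hBA, hBB, smul_zero,
      add_zero, zero_add, smul_smul]
    congr 2 <;> field_simp <;> norm_num
  have hherm : ((2 : ℂ)⁻¹ • A + (2 : ℂ)⁻¹ • B).IsHermitian := by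
    simp [IsHermitian, hA.eq, hB.eq]
  have hpoly : ((2 : ℂ)⁻¹ • A + (2 : ℂ)⁻¹ • B) * ((2 : ℂ)⁻¹ • A + (2 : ℂ)⁻¹ • B) *
      ((2 : ℂ)⁻¹ • A + (2 : ℂ)⁻¹ • B) +
      ((1 / 2 * (1 / (2 * n)) : ℝ) : ℂ) • ((2 : ℂ)⁻¹ • A + (2 : ℂ)⁻¹ • B) =
      ((1 / 2 + 1 / (2 * n) : ℝ) : ℂ) •
        (((2 : ℂ)⁻¹ • A + (2 : ℂ)⁻¹ • B) * ((2 : ℂ)⁻¹ • A + (2 : ℂ)⁻¹ • B)) := by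
    rw [hsq]
    simp only [add_mul, mul_add, smul_mul_assoc, mul_smul_comm, hAA, hAB, hBA, hBB, smul_zero,
      add_zero, zero_add, smul_smul, smul_add]
    push_cast
    match_scalars <;> field_simp <;> ring
  have hlog2 : Real.log (1 / 2) = -Real.log 2 := by simp
  have hlogn : Real.log (1 / (2 * n)) = -(Real.log 2 + Real.log n) := by
    rw [one_div, Real.log_inv, Real.log_mul two_ne_zero hn.ne']
  obtain ⟨c₀, c₁, h₀, h₁⟩ : ∃ c₀ c₁ : ℝ, -Real.log (1 / 2) = c₀ + c₁ * (1 / 2) ∧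
      -Real.log (1 / (2 * n)) = c₀ + c₁ * (1 / (2 * n)) := by
    rcases eq_or_ne n 1 with rfl | hne
    · exact ⟨-Real.log (1 / 2), 0, by simp, by simp⟩
    · have : 1 - n ≠ 0 := sub_ne_zero.mpr hne.symm
      refine ⟨Real.log 2 - n * Real.log n / (1 - n), 2 * n * Real.log n / (1 - n), ?_, ?_⟩
      · rw [hlog2]; field_simp; ring
      · rw [hlogn]; field_simp; ring
  have htr : ((2 : ℂ)⁻¹ • A + (2 : ℂ)⁻¹ • B).trace = ((1 : ℝ) : ℂ) := by
    simp [htA, htB]; norm_num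
  have htr' : ((4 : ℂ)⁻¹ • A + (4 * n : ℂ)⁻¹ • B).trace = ((1 / 4 + 1 / (4 * n) : ℝ) : ℂ) := by
    simp [htA, htB]
  rw [vN_eq_of_mul_self_mul_self hherm h₀ h₁ hpoly, hsq, htr, htr', Complex.ofReal_re,
    Complex.ofReal_re]
  rw [hlog2] at h₀
  rw [hlogn] at h₁
  have e : 1 / (4 * n) = 1 / (2 * n) / 2 := by field_simp; norm_num
  rw [e]
  linear_combination -h₀ / 2 - h₁ / 2

lemma tensorId_add {d d' n : ℕ} {C : Matrix (Fin d) (Fin d) ℂ → Matrix (Fin d') (Fin d') ℂ}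
    (hC : IsLinearMap ℂ C) (X Y : Matrix (Fin d × Fin n) (Fin d × Fin n) ℂ) :
    tensorId C (X + Y) = tensorId C X + tensorId C Y := by
  ext p q
  exact congrFun₂ (hC.map_add (of fun i j => X (i, p.2) (j, q.2))
    (of fun i j => Y (i, p.2) (j, q.2))) p.1 q.1

lemma tensorId_smul {d d' n : ℕ} {C : Matrix (Fin d) (Fin d) ℂ → Matrix (Fin d') (Fin d') ℂ}
    (hC : IsLinearMap ℂ C) (c : ℂ) (X : Matrix (Fin d × Fin n) (Fin d × Fin n) ℂ) :
    tensorId C (c • X) = c • tensorId C X := by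
  ext p q
  exact congrFun₂ (hC.map_smul c (of fun i j => X (i, p.2) (j, q.2))) p.1 q.1

lemma tensorId_kronecker {d d' n : ℕ}
    {C : Matrix (Fin d) (Fin d) ℂ → Matrix (Fin d') (Fin d') ℂ}
    (hC : IsLinearMap ℂ C) (X : Matrix (Fin d) (Fin d) ℂ) (Z : Matrix (Fin n) (Fin n) ℂ) :
    tensorId C (X ⊗ₖ Z) = C X ⊗ₖ Z := by
  ext p q
  have h : (of fun i j => (X ⊗ₖ Z) (i, p.2) (j, q.2)) = Z p.2 q.2 • X := by
    ext i j
    simp [mul_comm]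
  rw [tensorId, of_apply, h, hC.map_smul, kroneckerMap_apply, Matrix.smul_apply, smul_eq_mul, mul_comm]

lemma IsCompletelyPositive.posSemidef_tensorId {d d' n : ℕ}
    {C : Matrix (Fin d) (Fin d) ℂ → Matrix (Fin d') (Fin d') ℂ} (hC : IsCompletelyPositive C)
    {X : Matrix (Fin d × Fin n) (Fin d × Fin n) ℂ} (hX : X.PosSemidef) :
    (tensorId C X).PosSemidef :=
  (hC n (X.submatrix Prod.swap Prod.swap) (hX.submatrix _)).submatrix Prod.swap

lemma Matrix.PosSemidef.one_sub_of_mul_self {ι : Type*} [Fintype ι] [DecidableEq ι]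
    {P : Matrix ι ι ℂ} (hP : P.IsHermitian) (hPP : P * P = P) : (1 - P).PosSemidef := by
  have h : 1 - P = (1 - P)ᴴ * (1 - P) := by
    simp [hP.eq, mul_sub, sub_mul, hPP]
  rw [h]
  exact posSemidef_conjTranspose_mul_self _

lemma Matrix.IsHermitian.vecMulVec_star_mul {ι : Type*} [Fintype ι] {M : Matrix ι ι ℂ}
    (hM : M.IsHermitian) {u : ι → ℂ} {l : ℝ} (hu : M *ᵥ u = (l : ℂ) • u) :
    vecMulVec u (star u) * M = (l : ℂ) • vecMulVec u (star u) := by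
  have h : star u ᵥ* M = (l : ℂ) • star u := by
    have := congrArg star hu
    rwa [star_mulVec, hM.eq, star_smul, Complex.star_def, Complex.conj_ofReal] at this
  rw [vecMulVec_mul, h, vecMulVec_smul]

lemma Matrix.IsHermitian.trace_mul_anticommutator {ι : Type*} [Fintype ι] {M : Matrix ι ι ℂ}
    (hM : M.IsHermitian) {u : ι → ℂ} {l : ℝ} (hu : M *ᵥ u = (l : ℂ) • u) (X : Matrix ι ι ℂ) :
    (M * (X * vecMulVec u (star u) + vecMulVec u (star u) * X)).trace =
      2 * l * (vecMulVec u (star u) * X).trace := by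
  have h : M * vecMulVec u (star u) = (l : ℂ) • vecMulVec u (star u) := by
    rw [mul_vecMulVec, hu, smul_vecMulVec]
  rw [mul_add, trace_add, ← mul_assoc, trace_mul_comm, ← mul_assoc, hM.vecMulVec_star_mul hu,
    ← mul_assoc, h, smul_mul_assoc, trace_smul, smul_eq_mul]
  ring

/-- Any non-trivial post-selected measurement yields a work benefit which grows
without bound in the ancilla dimension: the conditional work benefit on success
is at least `E_min - E_max + T((½ - q) log d_a - log d_t)`, which tends to `+∞`
as `d_a → ∞` since `q < ½`. -/
theorem postselection_unbounded_work_benefit {dt da : ℕ} (hda : 1 ≤ da)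
    (Ht : Matrix (Fin dt) (Fin dt) ℂ) (hHt : Ht.IsHermitian)
    (Emin Emax : ℝ)
    (hEmin : IsLeast (Set.range hHt.eigenvalues) Emin)
    (hEmax : IsGreatest (Set.range hHt.eigenvalues) Emax)
    (T : ℝ) (hT : 0 < T)
    (M : Matrix (Fin dt) (Fin dt) ℂ) (hM : M.PosSemidef)
    (hMle : ((1 : Matrix (Fin dt) (Fin dt) ℂ) - M).PosSemidef)
    (lmax lmin : ℝ)
    (hlmax : IsGreatest (Set.range hM.1.eigenvalues) lmax)
    (hlmin : IsLeast (Set.range hM.1.eigenvalues) lmin)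
    (hsep : lmin < lmax)
    (u v : Fin dt → ℂ) (hu1 : star u ⬝ᵥ u = 1) (hv1 : star v ⬝ᵥ v = 1)
    (huv : star u ⬝ᵥ v = 0)
    (hMu : M.mulVec u = (lmax : ℂ) • u) (hMv : M.mulVec v = (lmin : ℂ) • v)
    (Csucc : Matrix (Fin dt) (Fin dt) ℂ → Matrix (Fin dt) (Fin dt) ℂ)
    (hlin : IsLinearMap ℂ Csucc) (hCP : IsCompletelyPositive Csucc)
    (hPOVM : ∀ X : Matrix (Fin dt) (Fin dt) ℂ, (Csucc X).trace = (M * X).trace)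
    (φ : Fin da → ℂ) (hφ : star φ ⬝ᵥ φ = 1)
    (ρs : Matrix (Fin dt × Fin da) (Fin dt × Fin da) ℂ)
    (hρs : ρs = (2 : ℂ)⁻¹ • (Matrix.vecMulVec u (star u) ⊗ₖ Matrix.vecMulVec φ (star φ)) +
        (2 : ℂ)⁻¹ • (Matrix.vecMulVec v (star v) ⊗ₖ
          ((da : ℂ)⁻¹ • (1 : Matrix (Fin da) (Fin da) ℂ))))
    (ρt : Matrix (Fin dt) (Fin dt) ℂ)
    (hρt : ρt = (2 : ℂ)⁻¹ • (Matrix.vecMulVec u (star u) + Matrix.vecMulVec v (star v)))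
    (psucc : ℝ) (hpsucc : psucc = (lmax + lmin) / 2)
    (σsucc : Matrix (Fin dt × Fin da) (Fin dt × Fin da) ℂ)
    (hσsucc : σsucc = ((psucc : ℂ))⁻¹ • tensorId Csucc ρs)
    (q : ℝ) (hq : q = lmin / (lmax + lmin))
    (W : ℝ)
    (hW : W = ((Csucc ((2 : ℂ)⁻¹ • (Ht * ρt + ρt * Ht))).trace).re / psucc -
        ((Ht * ρt).trace).re + T * (vN ρs - vN σsucc)) :
    Emin - Emax + T * ((1 / 2 - q) * Real.log da - Real.log dt) ≤ W := by
  set U := vecMulVec u (star u) with hU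
  set V := vecMulVec v (star v) with hV
  set F := vecMulVec φ (star φ) with hF
  have hUU : U * U = U := by rw [hU, vecMulVec_mul_vecMulVec, hu1, one_smul]
  have hVV : V * V = V := by rw [hV, vecMulVec_mul_vecMulVec, hv1, one_smul]
  have hFF : F * F = F := by rw [hF, vecMulVec_mul_vecMulVec, hφ, one_smul]
  have hvu : star v ⬝ᵥ u = 0 := by
    rw [star_dotProduct, huv, star_zero]
  have hUV : U * V = 0 := by rw [hU, hV, vecMulVec_mul_vecMulVec, huv, zero_smul, vecMulVec_zero]
  have hVU : V * U = 0 := by rw [hU, hV, vecMulVec_mul_vecMulVec, hvu, zero_smul, vecMulVec_zero]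
  have htU : U.trace = 1 := by rw [hU, trace_vecMulVec, dotProduct_comm, hu1]
  have htV : V.trace = 1 := by rw [hV, trace_vecMulVec, dotProduct_comm, hv1]
  have htF : F.trace = 1 := by rw [hF, trace_vecMulVec, dotProduct_comm, hφ]
  have hUp : U.PosSemidef := posSemidef_vecMulVec_self_star u
  have hVp : V.PosSemidef := posSemidef_vecMulVec_self_star v
  have hFp : F.PosSemidef := posSemidef_vecMulVec_self_star φ
  have hIp : ((da : ℂ)⁻¹ • (1 : Matrix (Fin da) (Fin da) ℂ)).PosSemidef :=
    PosSemidef.one.smul (by simp)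
  have hUM : U * M = (lmax : ℂ) • U := hM.1.vecMulVec_star_mul hMu
  have hVM : V * M = (lmin : ℂ) • V := hM.1.vecMulVec_star_mul hMv
  have hda0 : (0 : ℝ) < da := by exact_mod_cast hda
  have hdaC : (da : ℂ) ≠ 0 := by exact_mod_cast hda0.ne'
  have hdt0 : (0 : ℝ) < dt := by
    obtain ⟨i, -⟩ := hlmax.1
    exact_mod_cast i.pos
  have hlmin0 : 0 ≤ lmin := by
    obtain ⟨i, rfl⟩ := hlmin.1
    exact hM.eigenvalues_nonneg i
  have hsum : 0 < lmax + lmin := by linarith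
  have hsumC : (lmax : ℂ) + lmin ≠ 0 := by exact_mod_cast hsum.ne'
  have hq0 : 0 ≤ q := hq ▸ div_nonneg hlmin0 hsum.le
  have hq2 : q ≤ 1 / 2 := by
    rw [hq, div_le_iff₀ hsum]; linarith
  have hq1 : lmax / (lmax + lmin) = 1 - q := by
    rw [hq]; field_simp; ring
  -- the energy term
  have hE1 : ((Csucc ((2 : ℂ)⁻¹ • (Ht * ρt + ρt * Ht))).trace).re / psucc =
      (1 - q) * (U * Ht).trace.re + q * (V * Ht).trace.re := by
    have h : (Csucc ((2 : ℂ)⁻¹ • (Ht * ρt + ρt * Ht))).trace =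
        ((1 / 2 * lmax : ℝ) : ℂ) * (U * Ht).trace + ((1 / 2 * lmin : ℝ) : ℂ) * (V * Ht).trace := by
      have hsplit : Ht * ρt + ρt * Ht =
          (2 : ℂ)⁻¹ • ((Ht * U + U * Ht) + (Ht * V + V * Ht)) := by
        rw [hρt, mul_smul_comm, smul_mul_assoc, ← smul_add, mul_add, add_mul, add_add_add_comm]
      rw [hPOVM, hsplit, smul_smul, mul_smul_comm, trace_smul, mul_add, trace_add,
        hM.1.trace_mul_anticommutator hMu, hM.1.trace_mul_anticommutator hMv, smul_eq_mul]
      push_cast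
      ring
    rw [h, Complex.add_re, Complex.re_ofReal_mul, Complex.re_ofReal_mul, hpsucc, ← hq1, hq]
    field_simp
  have hE2 : (Ht * ρt).trace.re = 1 / 2 * (U * Ht).trace.re + 1 / 2 * (V * Ht).trace.re := by
    have h : (Ht * ρt).trace = ((1 / 2 : ℝ) : ℂ) * (U * Ht).trace +
        ((1 / 2 : ℝ) : ℂ) * (V * Ht).trace := by
      rw [trace_mul_comm, hρt]
      simp only [add_mul, smul_mul_assoc, trace_smul, trace_add, smul_eq_mul]
      push_cast
      ring
    rw [h, Complex.add_re, Complex.re_ofReal_mul, Complex.re_ofReal_mul]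
  have hEU := hHt.le_trace_mul_re (fun k => hEmin.2 ⟨k, rfl⟩) hUp
  have hEV := hHt.trace_mul_re_le (fun k => hEmax.2 ⟨k, rfl⟩) hVp
  rw [htU, Complex.one_re, mul_one] at hEU
  rw [htV, Complex.one_re, mul_one] at hEV
  have hEle : Emin ≤ Emax := hEmin.2 hEmax.1
  -- the entropy of the input
  have hSρ : vN ρs = Real.log 2 + 1 / 2 * Real.log da := by
    rw [hρs]
    refine vN_half_add_half (hUp.kronecker hFp).1 (hVp.kronecker hIp).1 hda0 ?_ ?_ ?_ ?_ ?_ ?_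
    · rw [← mul_kronecker_mul, hUU, hFF]
    · rw [← mul_kronecker_mul, hUV, zero_kronecker]
    · rw [← mul_kronecker_mul, hVU, zero_kronecker]
    · rw [← mul_kronecker_mul, hVV, smul_mul_assoc, one_mul, kronecker_smul]
      simp
    · rw [trace_kronecker, htU, htF, one_mul]
    · rw [trace_kronecker, htV, trace_smul, trace_one]
      simp [hdaC]
  -- the entropy of the output
  have hσ : σsucc = ((lmax + lmin : ℝ) : ℂ)⁻¹ • (Csucc U ⊗ₖ F) +
      ((lmax + lmin : ℝ) : ℂ)⁻¹ • (Csucc V ⊗ₖ ((da : ℂ)⁻¹ • (1 : Matrix (Fin da) (Fin da) ℂ))) := by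
    rw [hσsucc, hρs, tensorId_add hlin, tensorId_smul hlin, tensorId_smul hlin,
      tensorId_kronecker hlin, tensorId_kronecker hlin, ← smul_add, ← smul_add, smul_smul, hpsucc]
    congr 1
    push_cast
    field_simp
  have hσp : σsucc.PosSemidef := by
    have h2 : (0 : ℂ) ≤ 2⁻¹ := by simp
    have h3 : (0 : ℂ) ≤ (psucc : ℂ)⁻¹ := by
      rw [← Complex.ofReal_inv]
      exact Complex.zero_le_real.mpr (inv_nonneg.mpr (by rw [hpsucc]; linarith))
    rw [hσsucc, hρs]
    exact (hCP.posSemidef_tensorId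
      (((hUp.kronecker hFp).smul h2).add ((hVp.kronecker hIp).smul h2))).smul h3
  have htCU : (Csucc U).trace = lmax := by
    rw [hPOVM, trace_mul_comm, hUM, trace_smul, htU, smul_eq_mul, mul_one]
  have htCV : (Csucc V).trace = lmin := by
    rw [hPOVM, trace_mul_comm, hVM, trace_smul, htV, smul_eq_mul, mul_one]
  set P : Matrix (Fin dt × Fin da) (Fin dt × Fin da) ℂ :=
    (1 : Matrix (Fin dt) (Fin dt) ℂ) ⊗ₖ F with hPdef
  have hPp : P.PosSemidef := PosSemidef.one.kronecker hFp
  have hPP : P * P = P := by rw [hPdef, ← mul_kronecker_mul, hFF, one_mul]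
  have htP : P.trace = (dt : ℝ) := by
    rw [hPdef, trace_kronecker, htF, trace_one]
    simp
  have htP' : (1 - P).trace = ((dt * da - dt : ℝ) : ℂ) := by
    rw [trace_sub, htP, trace_one]
    simp
  have htσ : σsucc.trace = ((1 : ℝ) : ℂ) := by
    rw [hσ, trace_add, trace_smul, trace_smul, trace_kronecker, trace_kronecker, htCU, htCV, htF,
      trace_smul, trace_one]
    simp [hdaC]
    field_simp
  have htPσ : (P * σsucc).trace = ((1 - q + q / da : ℝ) : ℂ) := by
    rw [hσ, mul_add, mul_smul_comm, mul_smul_comm, hPdef, ← mul_kronecker_mul,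
      ← mul_kronecker_mul, hFF, one_mul, one_mul, mul_smul_comm, mul_one, trace_add, trace_smul,
      trace_smul, trace_kronecker, trace_kronecker, htCU, htCV, trace_smul, htF, ← hq1, hq]
    simp
    field_simp
  have htPσ' : ((1 - P) * σsucc).trace = ((q - q / da : ℝ) : ℂ) := by
    rw [sub_mul, one_mul, trace_sub, htσ, htPσ]
    push_cast
    ring
  have hSσ : vN σsucc ≤ Real.log 2 + Real.log dt + q * Real.log da := by
    have h := vN_le_of_posSemidef hσp hPp (.one_sub_of_mul_self hPp.1 hPP)
      (a := (2 * dt : ℝ)⁻¹) (b := (2 * dt * da : ℝ)⁻¹) (by positivity) (by positivity) (by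
        rw [htP, htP', htσ, Complex.ofReal_re, Complex.ofReal_re, Complex.ofReal_re]
        have : (2 * dt : ℝ)⁻¹ * dt + (2 * dt * da : ℝ)⁻¹ * (dt * da - dt) =
          1 - (2 * da : ℝ)⁻¹ := by field_simp; ring
        rw [this]
        exact sub_le_self _ (by positivity))
    rw [htPσ, htPσ', Complex.ofReal_re, Complex.ofReal_re, Real.log_inv, Real.log_inv,
      Real.log_mul (by positivity) hda0.ne', Real.log_mul two_ne_zero hdt0.ne'] at h
    have h2 : 0 ≤ q / da * Real.log da :=
      mul_nonneg (div_nonneg hq0 hda0.le) (Real.log_nonneg (by exact_mod_cast hda))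
    linarith
  rw [hW, hE1, hE2, hSρ]
  have hS := mul_le_mul_of_nonneg_left hSσ hT.le
  have hEV' := hHt.le_trace_mul_re (fun k => hEmin.2 ⟨k, rfl⟩) hVp
  have hE := mul_le_mul_of_nonneg_left (sub_le_sub hEU hEV) (sub_nonneg.mpr hq2)
  nlinarith [mul_nonneg (by linarith : 0 ≤ 1 / 2 + q) (sub_nonneg.mpr hEle)]
end
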